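/- Let $\Omega$ be a compact metric space and $\Phi: \{0,\ldots,T\} \times \Omega \to \mathbb{R}$ with each $\Phi_t$ lower semicontinuous and bounded below. Fix $t \in \{1,\ldots,T\}$. Then the map $(\omega, P) \mapsto \sup_{\tau \in \mathcal{T}_t} E_P[\Phi_\tau(\omega^t, \cdot)]$, defined on $\Omega_T \times \mathfrak{P}(\Omega_{T-t})$ (with the weak topology on probability measures), is lower semicontinuous. -/

import Mathlib

open MeasureTheory

open Filter Topology Set in
theorem aux_lsc_lintegral {Y : Type*} [TopologicalSpace Y] [SecondCountableTopology Y]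
    [TopologicalSpace.PseudoMetrizableSpace Y] [MeasurableSpace Y] [BorelSpace Y]
    (f : Y → ℝ) (hf : LowerSemicontinuous f) (h0 : ∀ y, 0 ≤ f y) :
    LowerSemicontinuous (fun Q : ProbabilityMeasure Y =>
      ∫⁻ y, ENNReal.ofReal (f y) ∂(Q : Measure Y)) := by
  rw [lowerSemicontinuous_iff_le_liminf]
  intro Q0
  have key : ∀ Q : ProbabilityMeasure Y, ∫⁻ y, ENNReal.ofReal (f y) ∂(Q : Measure Y)
      = ∫⁻ s in Ioi (0:ℝ), (Q : Measure Y) {a | s < f a} := fun Q =>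
    lintegral_eq_lintegral_meas_lt _ (ae_of_all _ h0) hf.measurable.aemeasurable
  simp_rw [key]
  refine le_trans ?_ (lintegral_liminf_le ?_)
  · refine lintegral_mono fun s => ?_
    exact ProbabilityMeasure.le_liminf_measure_open_of_tendsto tendsto_id
      (hf.isOpen_preimage s)
  · intro Q
    refine Antitone.measurable fun a b hab => measure_mono fun x hx => ?_
    exact lt_of_le_of_lt hab hx

theorem aux_lsc_prod {X : Type*} [TopologicalSpace X] [SecondCountableTopology X]
    [TopologicalSpace.PseudoMetrizableSpace X] [MeasurableSpace X] [BorelSpace X]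
    (f : X × X → ℝ) (hf : LowerSemicontinuous f) (h0 : ∀ y, 0 ≤ f y) :
    LowerSemicontinuous (fun p : X × ProbabilityMeasure X =>
      ∫⁻ y, ENNReal.ofReal (f (p.1, y)) ∂(p.2 : Measure X)) := by
  have h1 := aux_lsc_lintegral f hf h0
  have hc : Continuous (fun p : X × ProbabilityMeasure X => (diracProba p.1).prod p.2) :=
    ProbabilityMeasure.continuous_prod.comp
      ((continuous_diracProba.comp continuous_fst).prodMk continuous_snd)
  have h2 := h1.comp hc
  convert h2 using 2 with p
  simp only [Function.comp, ProbabilityMeasure.toMeasure_prod]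
  rw [lintegral_prod _ (by exact (hf.measurable.ennreal_ofReal).aemeasurable)]
  simp only [diracProba, ProbabilityMeasure.coe_mk]
  rw [lintegral_dirac']
  exact (hf.measurable.ennreal_ofReal).lintegral_prod_right'

open Set in
theorem aux_sets {Ω₁ : Type*} [MetricSpace Ω₁] [CompactSpace Ω₁]
    [SecondCountableTopology Ω₁] [MeasurableSpace Ω₁] [BorelSpace Ω₁]
    (x0 : ℕ → Ω₁) (N : ℕ) (A : ℕ → Set (ℕ → Ω₁)) (hA : ∀ k, MeasurableSet (A k))
    (hdep : ∀ k x y, (∀ j, j < k → x j = y j) → x ∈ A k → y ∈ A k)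
    (hdis : ∀ j k, j < k → ∀ x, x ∈ A j → x ∈ A k → False)
    (μ : ℕ → Measure (ℕ → Ω₁)) (hμ : ∀ k, IsFiniteMeasure (μ k))
    (ε : ENNReal) (hε : ε ≠ 0) :
    ∃ C V : ℕ → Set (ℕ → Ω₁), (∀ k, IsClosed (C k)) ∧ (∀ k, IsOpen (V k)) ∧
      (∀ k, V k ⊆ C k) ∧ (∀ j k, j < k → ∀ x, x ∈ V k → x ∉ C j) ∧
      (∀ k x y, (∀ j, j < k → x j = y j) → x ∈ C k → y ∈ C k) ∧
      (∀ k ≤ N, μ k (A k) ≤ μ k (V k) + ε) := by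
  let _ : MetricSpace (ℕ → Ω₁) := TopologicalSpace.metrizableSpaceMetric _
  let r : ℕ → (ℕ → Ω₁) → (ℕ → Ω₁) := fun k x j => if j < k then x j else x0 j
  have hr : ∀ k, Continuous (r k) := by
    intro k
    refine continuous_pi fun j => ?_
    by_cases h : j < k
    · simpa [r, h] using continuous_apply j
    · simpa [r, h] using continuous_const
  have hrA : ∀ k x, r k x ∈ A k ↔ x ∈ A k := by
    intro k x
    constructor
    · exact hdep k _ _ (fun j hj => by simp [r, hj])
    · exact hdep k _ _ (fun j hj => by simp [r, hj])
  have hrr : ∀ k x, r k (r k x) = r k x := by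
    intro k x; funext j; by_cases h : j < k <;> simp [r, h]
  have hK : ∀ k, ∃ K, K ⊆ A k ∧ IsClosed K ∧
      ((μ k).map (r k)) (A k) < ((μ k).map (r k)) K + ε := by
    intro k
    have := hμ k
    exact (hA k).exists_isClosed_lt_add (measure_ne_top _ _) hε
  choose K hKA hKc hKm using hK
  let K' : ℕ → Set (ℕ → Ω₁) := fun k => r k ⁻¹' K k
  have hK'c : ∀ k, IsClosed (K' k) := fun k => (hKc k).preimage (hr k)
  have hK'A : ∀ k, K' k ⊆ A k := fun k x hx => (hrA k x).1 (hKA k hx)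
  let L : ℕ → Set (ℕ → Ω₁) := fun k => ⋃ m ∈ Finset.Ioc k N, r k '' K' m
  have hL : ∀ k, IsClosed (L k) := by
    intro k
    refine IsCompact.isClosed ?_
    exact (Finset.Ioc k N).isCompact_biUnion fun m _ => (hK'c m).isCompact.image (hr k)
  have hKL : ∀ k, K' k ⊆ (L k)ᶜ := by
    intro k x hx hxL
    simp only [L, mem_iUnion, Finset.mem_Ioc] at hxL
    obtain ⟨m, ⟨hkm, _⟩, z, hz, rfl⟩ := hxL
    exact hdis k m hkm z ((hrA k z).1 (hK'A k hx)) (hK'A m hz)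
  have hU : ∀ k, ∃ U, IsOpen U ∧ K' k ⊆ U ∧ closure U ⊆ (L k)ᶜ := fun k =>
    normal_exists_closure_subset (hK'c k) (hL k).isOpen_compl (hKL k)
  choose U hUo hKU hUL using hU
  have hCc : ∀ k, IsClosed (r k ⁻¹' closure (U k)) := fun k => isClosed_closure.preimage (hr k)
  refine ⟨fun k => r k ⁻¹' closure (U k),
    fun k => r k ⁻¹' (U k) \ ⋃ j ∈ Finset.range k, r j ⁻¹' closure (U j),
    hCc, ?_, ?_, ?_, ?_, ?_⟩
  · intro k
    refine IsOpen.sdiff ((hUo k).preimage (hr k)) ?_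
    exact isClosed_biUnion_finset fun j _ => hCc j
  · intro k x hx
    exact subset_closure hx.1
  · intro j k hjk x hx hxC
    refine hx.2 ?_
    simp only [mem_iUnion, Finset.mem_range]
    exact ⟨j, hjk, hxC⟩
  · intro k x y hxy hx
    have : r k x = r k y := by
      funext j; by_cases h : j < k <;> simp [r, h, hxy]
    simpa [this] using hx
  · intro k hk
    have h1 := (hKm k).le
    rw [Measure.map_apply (hr k).measurable (hA k),
      Measure.map_apply (hr k).measurable (hKc k).measurableSet] at h1
    have h2 : r k ⁻¹' A k = A k := by ext x; exact hrA k x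
    rw [h2] at h1
    refine h1.trans ?_
    gcongr
    intro x hx
    refine ⟨hKU k ?_, ?_⟩
    · show r k (r k x) ∈ K k
      rw [hrr]; exact hx
    · simp only [mem_iUnion, Finset.mem_range, not_exists]
      intro j hj hxC
      refine hUL j hxC ?_
      simp only [L, mem_iUnion, Finset.mem_Ioc]
      exact ⟨k, ⟨hj, hk⟩, x, hx, rfl⟩

/-- Lower semicontinuity of the optimal stopping value in `(ω, P)`: if each `Φ s`
(`s ≤ T`) is lower semicontinuous, adapted, and bounded below by `c` on the compact
path space, then
`(ω, P) ↦ sup_{τ ∈ 𝒯_t} E_P[Φ_τ(ω^t, ·) - c]` is lower semicontinuous on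
`Ω_T × 𝔓(Ω_{T-t})` (probability measures with the topology of weak convergence);
the past `ω^t` and the future `ω'` are concatenated via
`j ↦ if j < t then ω j else ω' (j - t)`. -/
theorem stmt13 {Ω₁ : Type*} [MetricSpace Ω₁] [CompactSpace Ω₁]
    [SecondCountableTopology Ω₁] [MeasurableSpace Ω₁] [BorelSpace Ω₁]
    (T t : ℕ) (ht : 1 ≤ t) (htT : t ≤ T)
    (Φ : ℕ → (ℕ → Ω₁) → ℝ) (c : ℝ)
    (hlsc : ∀ s ≤ T, LowerSemicontinuous (Φ s))
    (hbd : ∀ s ≤ T, ∀ ω, c ≤ Φ s ω)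
    (hadapt : ∀ s ≤ T, ∀ ω ω' : ℕ → Ω₁, (∀ j, j < s → ω j = ω' j) → Φ s ω = Φ s ω') :
    LowerSemicontinuous
      (fun p : (ℕ → Ω₁) × ProbabilityMeasure (ℕ → Ω₁) =>
        ⨆ τ : {τ : (ℕ → Ω₁) → ℕ // Measurable τ ∧ (∀ ω, t ≤ τ ω ∧ τ ω ≤ T) ∧
            ∀ s : ℕ, ∀ ω ω' : ℕ → Ω₁, (∀ j, j < s → ω j = ω' j) → τ ω = s → τ ω' = s},
          ∫⁻ ω' : ℕ → Ω₁,
            ENNReal.ofReal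
              (Φ (τ.1 fun j => if j < t then p.1 j else ω' (j - t))
                 (fun j => if j < t then p.1 j else ω' (j - t)) - c)
            ∂(p.2 : Measure (ℕ → Ω₁))) := by
  classical
  let conc : (ℕ → Ω₁) → (ℕ → Ω₁) → (ℕ → Ω₁) := fun ω x j => if j < t then ω j else x (j - t)
  have hconc : Continuous (fun q : (ℕ → Ω₁) × (ℕ → Ω₁) => conc q.1 q.2) := by
    refine continuous_pi fun j => ?_
    by_cases h : j < t
    · simpa [conc, h, Function.comp_def] using (continuous_apply j).comp (continuous_fst (X := ℕ → Ω₁) (Y := ℕ → Ω₁))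
    · simpa [conc, h, Function.comp_def] using
        (continuous_apply (j - t)).comp (continuous_snd (X := ℕ → Ω₁) (Y := ℕ → Ω₁))
  let sh : (ℕ → Ω₁) → (ℕ → Ω₁) := fun z j => z (j + t)
  have hsh : ∀ ω x, sh (conc ω x) = x := by
    intro ω x; funext j; simp [sh, conc]
  have hshm : Measurable sh := measurable_pi_lambda _ fun j => measurable_pi_apply (j + t)
  rintro ⟨ω0, P0⟩ y hy
  obtain ⟨⟨τ, hτm, hτb, hτs⟩, hy⟩ := lt_iSup_iff.1 hy
  change y < ∫⁻ x, ENNReal.ofReal (Φ (τ (conc ω0 x)) (conc ω0 x) - c) ∂(P0 : Measure (ℕ → Ω₁)) at hy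
  have hc0 : Continuous (conc ω0) := hconc.comp (Continuous.prodMk_right ω0)
  rw [lintegral_eq_nnreal] at hy
  obtain ⟨φ, hy⟩ := lt_iSup_iff.1 hy
  obtain ⟨hφ, hyφ⟩ := lt_iSup_iff.1 hy
  rw [← SimpleFunc.lintegral_eq_lintegral] at hyφ
  set N := T - t with hN
  let A : ℕ → Set (ℕ → Ω₁) := fun k => {x | τ (conc ω0 x) = t + k}
  let g : ℕ → (ℕ → Ω₁) → ENNReal := fun k x => ENNReal.ofReal (Φ (t + k) (conc ω0 x) - c)
  have hg : ∀ k ∈ Finset.range (N + 1), Measurable (g k) := by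
    intro k hk
    rw [Finset.mem_range] at hk
    exact ((((hlsc (t + k) (by omega)).comp hc0).measurable).sub_const c).ennreal_ofReal
  have hA : ∀ k, MeasurableSet (A k) := fun k =>
    (hτm.comp hc0.measurable) (measurableSet_singleton (t + k))
  obtain ⟨M, hM⟩ : ∃ M : NNReal, ∀ x, φ x ≤ M :=
    ⟨φ.range.sup id, fun x => Finset.le_sup (f := id) (φ.mem_range_self x)⟩
  let μ : ℕ → Measure (ℕ → Ω₁) := fun k =>
    (P0 : Measure (ℕ → Ω₁)).withDensity (fun x => min (g k x) M)
  have hμ : ∀ k, IsFiniteMeasure (μ k) := by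
    intro k
    refine isFiniteMeasure_withDensity ?_
    refine ne_of_lt (lt_of_le_of_lt (lintegral_mono (g := fun _ => (M : ENNReal))
      fun x => min_le_right _ _) ?_)
    simp
  have hsum : y < ∑ k ∈ Finset.range (N + 1), μ k (A k) := by
    refine hyφ.trans_le ?_
    have h1 : ∀ k, μ k (A k) = ∫⁻ x, (A k).indicator (fun x => min (g k x) M) x
        ∂(P0 : Measure (ℕ → Ω₁)) := by
      intro k
      rw [lintegral_indicator (hA k), withDensity_apply _ (hA k)]
    simp_rw [h1]
    refine le_trans ?_ (lintegral_finsetSum _ fun k hk =>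
      ((hg k hk).min measurable_const).indicator (hA k)).le
    refine lintegral_mono fun x => ?_
    obtain ⟨hx1, hx2⟩ := hτb (conc ω0 x)
    have hk : τ (conc ω0 x) = t + (τ (conc ω0 x) - t) := by omega
    have hmem : τ (conc ω0 x) - t ∈ Finset.range (N + 1) := by
      rw [Finset.mem_range]; omega
    refine le_trans ?_ (Finset.single_le_sum (fun _ _ => zero_le) hmem)
    rw [Set.indicator_of_mem (show x ∈ A _ from hk)]
    refine le_min ?_ (ENNReal.coe_le_coe.2 (hM x))
    have := hφ x
    simp only [g]
    rw [← hk]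
    exact this
  obtain ⟨ε, hε, hyε⟩ : ∃ ε : ENNReal, ε ≠ 0 ∧
      y + (N + 1 : ℕ) * ε < ∑ k ∈ Finset.range (N + 1), μ k (A k) := by
    have hcont : Filter.Tendsto (fun ε : ENNReal => y + (N + 1 : ℕ) * ε) (nhdsWithin 0 (Set.Ioi 0))
        (nhds (y + (N + 1 : ℕ) * 0)) := by
      refine Filter.Tendsto.mono_left ?_ nhdsWithin_le_nhds
      exact tendsto_const_nhds.add
        (ENNReal.Tendsto.const_mul Filter.tendsto_id (Or.inr (ENNReal.natCast_ne_top _)))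
    rw [mul_zero, add_zero] at hcont
    obtain ⟨ε, h1, h2⟩ := ((hcont.eventually_lt_const hsum).and self_mem_nhdsWithin).exists
    exact ⟨ε, (ne_of_gt h2), h1⟩
  obtain ⟨C, V, hCc, hVo, hVC, hVC', hCdep, hest⟩ := aux_sets ω0 N A hA
    (by
      intro k x z hxz hx
      refine hτs (t + k) _ _ ?_ hx
      intro j hj
      by_cases h : j < t
      · simp [conc, h]
      · simp only [conc, h, if_false]
        exact hxz _ (by omega))
    (by
      intro j k hjk x h1 h2
      have h1' : τ (conc ω0 x) = t + j := h1
      have h2' : τ (conc ω0 x) = t + k := h2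
      omega) μ hμ ε hε
  have hV : y < ∑ k ∈ Finset.range (N + 1), μ k (V k) := by
    by_contra hcon
    rw [not_lt] at hcon
    refine absurd hyε (not_lt.2 ?_)
    calc ∑ k ∈ Finset.range (N + 1), μ k (A k)
        ≤ ∑ k ∈ Finset.range (N + 1), (μ k (V k) + ε) :=
          Finset.sum_le_sum fun k hk => hest k (by rw [Finset.mem_range] at hk; omega)
      _ = ∑ k ∈ Finset.range (N + 1), μ k (V k) + (N + 1 : ℕ) * ε := by
          rw [Finset.sum_add_distrib]; simp
      _ ≤ _ := by gcongr
  let f : ℕ → (ℕ → Ω₁) × (ℕ → Ω₁) → ℝ := fun k q =>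
    if q.2 ∈ V k then Φ (t + k) (conc q.1 q.2) - c else 0
  have hf0 : ∀ k ∈ Finset.range (N + 1), ∀ q, 0 ≤ f k q := by
    intro k hk q
    rw [Finset.mem_range] at hk
    simp only [f]
    split_ifs
    · exact sub_nonneg.2 (hbd _ (by omega) _)
    · exact le_rfl
  have hfl : ∀ k ∈ Finset.range (N + 1), LowerSemicontinuous (f k) := by
    intro k hk q b hb
    by_cases hq : q.2 ∈ V k
    · have hk' := hk
      rw [Finset.mem_range] at hk'
      have h1 : b + c < Φ (t + k) (conc q.1 q.2) := by
        simp only [f, hq, if_true] at hb; linarith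
      have h2 := ((hlsc (t + k) (by omega)).comp hconc) q (b + c) h1
      filter_upwards [h2, continuous_snd.continuousAt.preimage_mem_nhds ((hVo k).mem_nhds hq)]
        with q' h3 h4
      have h4' : q'.2 ∈ V k := h4
      have h3' : b + c < Φ (t + k) (conc q'.1 q'.2) := h3
      simp only [f, h4', if_true]; linarith
    · have h1 : b < 0 := by simpa [f, hq] using hb
      exact Filter.Eventually.of_forall fun q' => lt_of_lt_of_le h1 (hf0 k hk q')
  have hH : LowerSemicontinuous (fun p : (ℕ → Ω₁) × ProbabilityMeasure (ℕ → Ω₁) =>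
      ∑ k ∈ Finset.range (N + 1),
        ∫⁻ x, ENNReal.ofReal (f k (p.1, x)) ∂(p.2 : Measure (ℕ → Ω₁))) :=
    lowerSemicontinuous_sum fun k hk => aux_lsc_prod (f k) (hfl k hk) (hf0 k hk)
  have hH0 : y < ∑ k ∈ Finset.range (N + 1),
        ∫⁻ x, ENNReal.ofReal (f k (ω0, x)) ∂(P0 : Measure (ℕ → Ω₁)) := by
    refine hV.trans_le (Finset.sum_le_sum fun k hk => ?_)
    simp only [μ]
    rw [withDensity_apply _ (hVo k).measurableSet, ← lintegral_indicator (hVo k).measurableSet]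
    refine lintegral_mono fun x => ?_
    by_cases hx : x ∈ V k
    · simp [f, hx, g]
    · simp [hx]
  filter_upwards [hH (ω0, P0) y hH0] with p hp
  refine hp.trans_le ?_
  -- the new stopping time
  have hex : ∀ z : ℕ → Ω₁, ∃ k, k = N ∨ sh z ∈ C k := fun z => ⟨N, Or.inl rfl⟩
  let κ : (ℕ → Ω₁) → ℕ := fun z => Nat.find (hex z)
  have hκm : Measurable κ := by
    refine measurable_find hex fun k => ?_
    by_cases h : k = N
    · simp [h]
    · simpa [h] using (show MeasurableSet {z | sh z ∈ C k} from hshm (hCc k).measurableSet)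
  have hκN : ∀ z, κ z ≤ N := fun z => Nat.find_min' (hex z) (Or.inl rfl)
  let σ : (ℕ → Ω₁) → ℕ := fun z => t + κ z
  have hσ : Measurable σ ∧ (∀ ω, t ≤ σ ω ∧ σ ω ≤ T) ∧
      ∀ s : ℕ, ∀ ω ω' : ℕ → Ω₁, (∀ j, j < s → ω j = ω' j) → σ ω = s → σ ω' = s := by
    refine ⟨hκm.const_add t, fun z => ⟨Nat.le_add_right _ _, ?_⟩, ?_⟩
    · have := hκN z
      simp only [σ]; omega
    · intro s z z' hz hs
      have hiff : ∀ k, t + k ≤ s → (sh z ∈ C k ↔ sh z' ∈ C k) := by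
        intro k hk
        constructor
        · exact hCdep k _ _ fun j hj => hz _ (by omega)
        · exact hCdep k _ _ fun j hj => (hz _ (by omega)).symm
      have hκ : κ z' = κ z := by
        refine (Nat.find_eq_iff (hex z')).2 ⟨?_, ?_⟩
        · rw [← hiff _ (by simp only [σ] at hs; omega)]
          exact Nat.find_spec (hex z)
        · intro n hn
          rw [← hiff _ (by simp only [σ] at hs; omega)]
          exact Nat.find_min (hex z) hn
      simp only [σ] at hs ⊢
      rw [hκ]; exact hs
  refine le_trans ?_ (le_iSup _ (⟨σ, hσ⟩ : {τ : (ℕ → Ω₁) → ℕ // Measurable τ ∧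
    (∀ ω, t ≤ τ ω ∧ τ ω ≤ T) ∧
      ∀ s : ℕ, ∀ ω ω' : ℕ → Ω₁, (∀ j, j < s → ω j = ω' j) → τ ω = s → τ ω' = s}))
  refine le_trans (lintegral_finsetSum _ fun k hk =>
    ((hfl k hk).measurable.comp measurable_prodMk_left).ennreal_ofReal).ge (lintegral_mono fun x => ?_)
  change _ ≤ ENNReal.ofReal (Φ (σ (conc p.1 x)) (conc p.1 x) - c)
  have hσk : ∀ k ∈ Finset.range (N + 1), x ∈ V k → κ (conc p.1 x) = k := by
    intro k hk hx
    rw [Finset.mem_range] at hk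
    refine (Nat.find_eq_iff _).2 ⟨Or.inr (by rw [hsh]; exact hVC k hx), ?_⟩
    rintro n hn (h | h)
    · omega
    · rw [hsh] at h
      exact hVC' n k hn x hx h
  by_cases hx : ∃ k ∈ Finset.range (N + 1), x ∈ V k
  · obtain ⟨k, hk, hxk⟩ := hx
    rw [Finset.sum_eq_single_of_mem k hk]
    · simp only [f, Function.comp, hxk, if_true, σ, hσk k hk hxk]
      exact le_rfl
    · intro j hj hjk
      have : x ∉ V j := fun h => hjk ((hσk j hj h).symm.trans (hσk k hk hxk))
      simp [f, this]
  · rw [Finset.sum_eq_zero]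
    · exact zero_le
    · intro k hk
      have : x ∉ V k := fun h => hx ⟨k, hk, h⟩
      simp [f, this]
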